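/- Coherence of the right BAVaR: let α ∈ (0,1), let x ∈ X, and let π be a policy that is α-coherent for every reward function r ∈ ℝ^{X×A×X} (e.g. any deterministic policy). Define η(u) = (1−γ) V₂^π(x; −u) for u ∈ ℝ^{X×A×X} (so u is the negated reward function). Then η is a coherent risk measure: (a) translation invariance: η(u + β·𝟏) = η(u) − β for all β ∈ ℝ; (b) sub-additivity: η(u₁ + u₂) ≤ η(u₁) + η(u₂); (c) positive homogeneity: η(β·u) = β·η(u) for all β ≥ 0; (d) monotonicity: if u₁ ≤ u₂ pointwise then η(u₁) ≥ η(u₂). -/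

import Mathlib

open MeasureTheory ProbabilityTheory Finset Set

noncomputable section

/-- Quantile (generalized inverse distribution) function of a measure on `ℝ`. -/
def quantileFn (ν : Measure ℝ) (τ : ℝ) : ℝ :=
  sInf {z : ℝ | τ ≤ cdf ν z}

/-- Left average value-at-risk at level `α`. -/
def avarLeft (α : ℝ) (ν : Measure ℝ) : ℝ :=
  (1 / α) * ∫ τ in (0:ℝ)..α, quantileFn ν τ

/-- Right average value-at-risk at level `1 - α`. -/
def avarRight (α : ℝ) (ν : Measure ℝ) : ℝ :=
  (1 / (1 - α)) * ∫ τ in α..(1:ℝ), quantileFn ν τ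

/-- A measure on `ℝ` with bounded support. -/
def HasBoundedSupport (ν : Measure ℝ) : Prop :=
  ∃ a b : ℝ, ν (Set.Icc a b)ᶜ = 0

/-- Finite Markov decision process with fixed state and action spaces. -/
structure MDP (X A : Type) [Fintype X] [Fintype A] where
  P : X → A → X → ℝ
  r : X → A → X → ℝ
  γ : ℝ
  P_nonneg : ∀ x a x', 0 ≤ P x a x'
  P_sum_one : ∀ x a, ∑ x', P x a x' = 1
  γ_nonneg : 0 ≤ γ
  γ_lt_one : γ < 1

variable {X A : Type} [Fintype X] [Fintype A]

/-- A stationary Markovian policy. -/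
def IsPolicy (π : X → A → ℝ) : Prop :=
  (∀ x a, 0 ≤ π x a) ∧ ∀ x, ∑ a, π x a = 1

/-- The discrete measure `(T^π D_{α,Q})^{(x,a)}`. -/
def diatomicMeasure (M : MDP X A) (α : ℝ) (π : X → A → ℝ)
    (Q : X → A → ℝ × ℝ) (x : X) (a : A) : Measure ℝ :=
  ∑ x' : X, ∑ a' : A, ENNReal.ofReal (M.P x a x' * π x' a') •
    (ENNReal.ofReal α • Measure.dirac (M.r x a x' + M.γ * (Q x' a').1)
      + ENNReal.ofReal (1 - α) • Measure.dirac (M.r x a x' + M.γ * (Q x' a').2))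

/-- The diatomic Bellman operator `T^π_α`. -/
def diatomicT (M : MDP X A) (α : ℝ) (π : X → A → ℝ)
    (Q : X → A → ℝ × ℝ) : X → A → ℝ × ℝ :=
  fun x a => (avarLeft α (diatomicMeasure M α π Q x a),
              avarRight α (diatomicMeasure M α π Q x a))

section Quantile

lemma quantileFn_le_iff (ν : Measure ℝ) {τ : ℝ} (hτ : τ ∈ Set.Ioo (0:ℝ) 1) (z : ℝ) :
    quantileFn ν τ ≤ z ↔ τ ≤ cdf ν z := by
  have hbdd : BddBelow {z : ℝ | τ ≤ cdf ν z} := by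
    obtain ⟨b, hb⟩ := ((tendsto_cdf_atBot ν).eventually_lt_const hτ.1).exists
    refine ⟨b, fun y hy => ?_⟩
    by_contra! hlt
    exact absurd (le_trans hy (monotone_cdf ν hlt.le)) (not_le.2 hb)
  have hne : {z : ℝ | τ ≤ cdf ν z}.Nonempty := by
    obtain ⟨b, hb⟩ := ((tendsto_cdf_atTop ν).eventually_const_lt hτ.2).exists
    exact ⟨b, hb.le⟩
  refine ⟨fun h => ?_, fun h => csInf_le hbdd h⟩
  have hright : Filter.Tendsto (cdf ν) (nhdsWithin z (Set.Ioi z)) (nhds (cdf ν z)) :=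
    ((cdf ν).right_continuous z).tendsto.mono_left (nhdsWithin_mono z Set.Ioi_subset_Ici_self)
  refine ge_of_tendsto hright ?_
  filter_upwards [self_mem_nhdsWithin] with y hy
  obtain ⟨w, hw, hwy⟩ := exists_lt_of_csInf_lt hne (lt_of_le_of_lt h hy)
  exact le_trans hw (monotone_cdf ν hwy.le)

lemma monotoneOn_quantileFn (ν : Measure ℝ) [IsProbabilityMeasure ν] :
    MonotoneOn (quantileFn ν) (Set.Ioo (0:ℝ) 1) :=
  fun _ hs _ ht hst => (quantileFn_le_iff ν hs _).2
    (hst.trans ((quantileFn_le_iff ν ht _).1 le_rfl))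

lemma aemeasurable_quantileFn (ν : Measure ℝ) [IsProbabilityMeasure ν] :
    AEMeasurable (quantileFn ν) (volume.restrict (Set.Ioo (0:ℝ) 1)) :=
  aemeasurable_restrict_of_monotoneOn measurableSet_Ioo (monotoneOn_quantileFn ν)

lemma map_quantileFn (ν : Measure ℝ) [IsProbabilityMeasure ν] :
    (volume.restrict (Set.Ioo (0:ℝ) 1)).map (quantileFn ν) = ν := by
  have : IsProbabilityMeasure (volume.restrict (Set.Ioo (0:ℝ) 1)) := ⟨by simp⟩
  have : IsProbabilityMeasure ((volume.restrict (Set.Ioo (0:ℝ) 1)).map (quantileFn ν)) :=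
    Measure.isProbabilityMeasure_map (aemeasurable_quantileFn ν)
  apply Measure.eq_of_cdf
  ext z
  rw [cdf_eq_real, measureReal_def,
    Measure.map_apply_of_aemeasurable (aemeasurable_quantileFn ν) measurableSet_Iic,
    Measure.restrict_apply' measurableSet_Ioo]
  have hset : quantileFn ν ⁻¹' Set.Iic z ∩ Set.Ioo 0 1 = Set.Iic (cdf ν z) ∩ Set.Ioo 0 1 := by
    ext τ
    simp only [Set.mem_inter_iff, Set.mem_preimage, Set.mem_Iic]
    exact and_congr_left fun h => quantileFn_le_iff ν h z
  have hvol : volume (Set.Iic (cdf ν z) ∩ Set.Ioo (0:ℝ) 1) = volume (Set.Ioc 0 (cdf ν z)) := by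
    rw [← measure_congr ((ae_eq_refl (Set.Iic (cdf ν z))).inter
      (Ioo_ae_eq_Ioc (μ := volume) (a := (0:ℝ)) (b := 1)).symm)]
    congr 1
    ext τ
    have := cdf_le_one ν z
    simp only [Set.mem_inter_iff, Set.mem_Iic, Set.mem_Ioc]
    constructor
    · rintro ⟨h1, h2, h3⟩
      exact ⟨h2, h1⟩
    · rintro ⟨h1, h2⟩
      exact ⟨h2, h1, h2.trans this⟩
  rw [hset, hvol, Real.volume_Ioc, sub_zero, ENNReal.toReal_ofReal (cdf_nonneg ν z)]

lemma integrableOn_quantileFn_comp (ν : Measure ℝ) [IsProbabilityMeasure ν] {g : ℝ → ℝ}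
    (hg : Integrable g ν) :
    IntegrableOn (fun τ => g (quantileFn ν τ)) (Set.Ioo (0:ℝ) 1) := by
  have h := hg
  rw [← map_quantileFn ν] at h
  exact h.comp_aemeasurable (aemeasurable_quantileFn ν)

lemma setIntegral_quantileFn_comp (ν : Measure ℝ) [IsProbabilityMeasure ν] {g : ℝ → ℝ}
    (hg : Integrable g ν) :
    ∫ τ in Set.Ioo (0:ℝ) 1, g (quantileFn ν τ) = ∫ v, g v ∂ν := by
  have h := hg.aestronglyMeasurable
  rw [← map_quantileFn ν] at h
  rw [← integral_map (aemeasurable_quantileFn ν) h, map_quantileFn]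

lemma avarRight_eq (ν : Measure ℝ) {α : ℝ} (hα : α ∈ Set.Ioo (0:ℝ) 1) :
    (1 - α) * avarRight α ν = ∫ τ in Set.Ioo α 1, quantileFn ν τ := by
  have : 1 - α ≠ 0 := by linarith [hα.2]
  rw [avarRight, intervalIntegral.integral_of_le hα.2.le, integral_Ioc_eq_integral_Ioo]
  field_simp

lemma avarLeft_eq (ν : Measure ℝ) {α : ℝ} (hα : α ∈ Set.Ioo (0:ℝ) 1) :
    α * avarLeft α ν = ∫ τ in Set.Ioc 0 α, quantileFn ν τ := by
  have : α ≠ 0 := hα.1.ne'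
  rw [avarLeft, intervalIntegral.integral_of_le hα.1.le]
  field_simp

lemma setIntegral_Ioo_split {α : ℝ} (hα : α ∈ Set.Ioo (0:ℝ) 1) {f : ℝ → ℝ}
    (hf : IntegrableOn f (Set.Ioo (0:ℝ) 1)) :
    ∫ τ in Set.Ioo (0:ℝ) 1, f τ = (∫ τ in Set.Ioc 0 α, f τ) + ∫ τ in Set.Ioo α 1, f τ := by
  rw [← Set.Ioc_union_Ioo_eq_Ioo hα.1.le hα.2] at hf ⊢
  refine setIntegral_union ?_ measurableSet_Ioo hf.left_of_union hf.right_of_union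
  exact Set.disjoint_left.2 fun τ h1 h2 => absurd h1.2 (not_le.2 h2.1)

/-- The two tail averages of a law recombine to its mean. -/
lemma avarLeft_add_avarRight (ν : Measure ℝ) [IsProbabilityMeasure ν] {α : ℝ} (hα : α ∈ Set.Ioo (0:ℝ) 1)
    (hν : Integrable (fun v => v) ν) :
    α * avarLeft α ν + (1 - α) * avarRight α ν = ∫ v, v ∂ν := by
  rw [avarLeft_eq ν hα, avarRight_eq ν hα,
    ← setIntegral_Ioo_split hα (integrableOn_quantileFn_comp ν hν),
    setIntegral_quantileFn_comp ν hν]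

lemma avarLeft_le_avarRight (ν : Measure ℝ) [IsProbabilityMeasure ν] {α : ℝ} (hα : α ∈ Set.Ioo (0:ℝ) 1)
    (hν : Integrable (fun v => v) ν) :
    avarLeft α ν ≤ avarRight α ν := by
  have hq := integrableOn_quantileFn_comp ν hν
  have h1 : α * avarLeft α ν ≤ α * quantileFn ν α := by
    rw [avarLeft_eq ν hα]
    have h := setIntegral_mono_on (μ := volume) (s := Set.Ioc 0 α) (g := fun _ => quantileFn ν α)
      (hq.mono_set fun τ h => ⟨h.1, h.2.trans_lt hα.2⟩) (by simp) measurableSet_Ioc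
      (fun τ h => monotoneOn_quantileFn ν ⟨h.1, h.2.trans_lt hα.2⟩ hα h.2)
    simpa [hα.1.le] using h
  have h2 : (1 - α) * quantileFn ν α ≤ (1 - α) * avarRight α ν := by
    rw [avarRight_eq ν hα]
    have h := setIntegral_mono_on (μ := volume) (s := Set.Ioo α 1) (f := fun _ => quantileFn ν α)
      (by simp) (hq.mono_set fun τ h => ⟨hα.1.trans h.1, h.2⟩) measurableSet_Ioo
      (fun τ h => monotoneOn_quantileFn ν hα ⟨hα.1.trans h.1, h.2⟩ h.1.le)
    simpa [hα.2.le] using h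
  exact (le_of_mul_le_mul_left h1 hα.1).trans (le_of_mul_le_mul_left h2 (by linarith [hα.2]))

/-- The easy half of the Rockafellar-Uryasev formula. -/
lemma avarRight_le (ν : Measure ℝ) [IsProbabilityMeasure ν] {α : ℝ} (hα : α ∈ Set.Ioo (0:ℝ) 1)
    (hν : Integrable (fun v => v) ν) (c : ℝ) :
    (1 - α) * avarRight α ν ≤ (1 - α) * c + ∫ v, max (v - c) 0 ∂ν := by
  have hg : Integrable (fun v => max (v - c) 0) ν := (hν.sub (integrable_const c)).pos_part
  have hq := integrableOn_quantileFn_comp ν hν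
  have hgq := integrableOn_quantileFn_comp ν hg
  have hsub : Set.Ioo α 1 ⊆ Set.Ioo 0 1 := fun τ h => ⟨hα.1.trans h.1, h.2⟩
  rw [avarRight_eq ν hα, ← setIntegral_quantileFn_comp ν hg, setIntegral_Ioo_split hα hgq]
  have h1 : 0 ≤ ∫ τ in Set.Ioc 0 α, max (quantileFn ν τ - c) 0 :=
    integral_nonneg fun τ => le_max_right _ _
  have h2 := setIntegral_mono_on (μ := volume) (s := Set.Ioo α 1)
    (g := fun τ => c + max (quantileFn ν τ - c) 0) (hq.mono_set hsub)
    ((integrableOn_const (by simp)).add (hgq.mono_set hsub)) measurableSet_Ioo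
    (fun τ _ => by linarith [le_max_left (quantileFn ν τ - c) 0])
  rw [integral_add (integrable_const c) (hgq.mono_set hsub)] at h2
  have h3 : ∫ _ in Set.Ioo α 1, c = (1 - α) * c := by simp [hα.2.le]
  linarith

/-- The infimum in the Rockafellar-Uryasev formula is attained. -/
lemma exists_avarRight_eq (ν : Measure ℝ) [IsProbabilityMeasure ν] {α : ℝ} (hα : α ∈ Set.Ioo (0:ℝ) 1)
    (hν : Integrable (fun v => v) ν) :
    ∃ c, (1 - α) * avarRight α ν = (1 - α) * c + ∫ v, max (v - c) 0 ∂ν := by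
  refine ⟨quantileFn ν α, ?_⟩
  set c := quantileFn ν α
  have hg : Integrable (fun v => max (v - c) 0) ν := (hν.sub (integrable_const c)).pos_part
  have hgq := integrableOn_quantileFn_comp ν hg
  have hsub : Set.Ioo α 1 ⊆ Set.Ioo 0 1 := fun τ h => ⟨hα.1.trans h.1, h.2⟩
  rw [avarRight_eq ν hα, ← setIntegral_quantileFn_comp ν hg, setIntegral_Ioo_split hα hgq]
  have h1 : ∫ τ in Set.Ioc 0 α, max (quantileFn ν τ - c) 0 = 0 :=
    setIntegral_eq_zero_of_forall_eq_zero fun τ h => max_eq_right (sub_nonpos.2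
      (monotoneOn_quantileFn ν ⟨h.1, h.2.trans_lt hα.2⟩ hα h.2))
  have h2 : ∫ τ in Set.Ioo α 1, quantileFn ν τ
      = ∫ τ in Set.Ioo α 1, (c + max (quantileFn ν τ - c) 0) := by
    refine setIntegral_congr_fun measurableSet_Ioo fun τ h => ?_
    have : c ≤ quantileFn ν τ := monotoneOn_quantileFn ν hα ⟨hα.1.trans h.1, h.2⟩ h.1.le
    simp [max_eq_left (sub_nonneg.2 this)]
  have h3 : ∫ _ in Set.Ioo α 1, c = (1 - α) * c := by simp [hα.2.le]
  rw [h2, integral_add (integrable_const c) (hgq.mono_set hsub), h1, h3, zero_add]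

end Quantile

section Bellman

/-- Expectation over the next state-action pair. -/
def nextExp (M : MDP X A) (π : X → A → ℝ) (x : X) (a : A) (f : X → A → ℝ) : ℝ :=
  ∑ x', ∑ a', M.P x a x' * π x' a' * f x' a'

lemma nextExp_mono (M : MDP X A) {π : X → A → ℝ} (hπ : IsPolicy π) (x : X) (a : A)
    {f g : X → A → ℝ} (h : ∀ x' a', f x' a' ≤ g x' a') :
    nextExp M π x a f ≤ nextExp M π x a g :=
  Finset.sum_le_sum fun x' _ => Finset.sum_le_sum fun a' _ =>
    mul_le_mul_of_nonneg_left (h x' a') (mul_nonneg (M.P_nonneg _ _ _) (hπ.1 _ _))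

lemma nextExp_const (M : MDP X A) {π : X → A → ℝ} (hπ : IsPolicy π) (x : X) (a : A) (c : ℝ) :
    nextExp M π x a (fun _ _ => c) = c := by
  simp only [nextExp, ← Finset.sum_mul, ← Finset.mul_sum, hπ.2, mul_one, M.P_sum_one, one_mul]

lemma nextExp_lin (M : MDP X A) (π : X → A → ℝ) (x : X) (a : A) (s t : ℝ) (f g : X → A → ℝ) :
    nextExp M π x a (fun x' a' => s * f x' a' + t * g x' a')
      = s * nextExp M π x a f + t * nextExp M π x a g := by
  simp only [nextExp, Finset.mul_sum, ← Finset.sum_add_distrib]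
  exact Finset.sum_congr rfl fun x' _ => Finset.sum_congr rfl fun a' _ => by ring

lemma integrable_diatomicMeasure (M : MDP X A) (α : ℝ) (π : X → A → ℝ)
    (Q : X → A → ℝ × ℝ) (x : X) (a : A) (g : ℝ → ℝ) :
    Integrable g (diatomicMeasure M α π Q x a) := by
  refine integrable_finsetSum_measure.2 fun x' _ => integrable_finsetSum_measure.2 fun a' _ => ?_
  exact (((integrable_dirac enorm_lt_top).smul_measure ENNReal.ofReal_ne_top).add_measure
    ((integrable_dirac enorm_lt_top).smul_measure ENNReal.ofReal_ne_top)).smul_measure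
    ENNReal.ofReal_ne_top

lemma integral_diatomicMeasure (M : MDP X A) {α : ℝ} (hα : α ∈ Set.Ioo (0:ℝ) 1)
    {π : X → A → ℝ} (hπ : IsPolicy π) (Q : X → A → ℝ × ℝ) (x : X) (a : A) (g : ℝ → ℝ) :
    ∫ v, g v ∂(diatomicMeasure M α π Q x a) = nextExp M π x a fun x' a' =>
      α * g (M.r x a x' + M.γ * (Q x' a').1) + (1 - α) * g (M.r x a x' + M.γ * (Q x' a').2) := by
  have hint := integrable_diatomicMeasure M α π Q x a g
  rw [diatomicMeasure] at hint ⊢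
  have hx := integrable_finsetSum_measure.1 hint
  rw [integral_finsetSum_measure hx]
  refine Finset.sum_congr rfl fun x' _ => ?_
  rw [integral_finsetSum_measure (integrable_finsetSum_measure.1 (hx x' (Finset.mem_univ _)))]
  refine Finset.sum_congr rfl fun a' _ => ?_
  rw [integral_smul_measure, integral_add_measure
    ((integrable_dirac enorm_lt_top).smul_measure ENNReal.ofReal_ne_top)
    ((integrable_dirac enorm_lt_top).smul_measure ENNReal.ofReal_ne_top),
    integral_smul_measure, integral_smul_measure, integral_dirac, integral_dirac,
    ENNReal.toReal_ofReal (mul_nonneg (M.P_nonneg _ _ _) (hπ.1 _ _)),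
    ENNReal.toReal_ofReal hα.1.le, ENNReal.toReal_ofReal (by linarith [hα.2])]
  simp only [smul_eq_mul]

lemma isProbabilityMeasure_diatomicMeasure (M : MDP X A) {α : ℝ} (hα : α ∈ Set.Ioo (0:ℝ) 1)
    {π : X → A → ℝ} (hπ : IsPolicy π) (Q : X → A → ℝ × ℝ) (x : X) (a : A) :
    IsProbabilityMeasure (diatomicMeasure M α π Q x a) := by
  have h := integral_diatomicMeasure M hα hπ Q x a fun _ => 1
  rw [integral_const, smul_eq_mul, mul_one] at h
  have hone : nextExp M π x a (fun _ _ => α * 1 + (1 - α) * 1) = 1 := by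
    rw [nextExp_const M hπ]
    ring
  rw [hone, measureReal_def] at h
  exact ⟨(ENNReal.toReal_eq_one_iff _).1 h⟩

/-- A function that a monotone `γ`-contraction forces below itself is nonpositive. -/
lemma nonpos_of_contraction {γ : ℝ} (hγ : γ < 1) {f : X → A → ℝ}
    (h : ∀ D, 0 ≤ D → (∀ y b, f y b ≤ D) → ∀ y b, f y b ≤ γ * D) (y : X) (b : A) :
    f y b ≤ 0 := by
  obtain ⟨k, -, hk⟩ := Finset.exists_max_image Finset.univ (fun k : X × A => f k.1 k.2)
    ⟨(y, b), Finset.mem_univ _⟩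
  have hmax : ∀ y b, f y b ≤ f k.1 k.2 := fun y b => hk (y, b) (Finset.mem_univ _)
  by_contra! hpos
  have hk0 : 0 < f k.1 k.2 := hpos.trans_le (hmax y b)
  have := h _ hk0.le hmax k.1 k.2
  nlinarith

lemma max_diatomic_le {α γ D a b R₁ R₂ c₁ c₂ : ℝ} (hα : α ∈ Set.Ioo (0:ℝ) 1) (hγ : 0 ≤ γ)
    (hD : 0 ≤ D) (ha : 0 ≤ a) (hb : 0 ≤ b) {p q₁ q₂ : ℝ × ℝ}
    (hmean : α * p.1 + (1 - α) * p.2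
      = a * (α * q₁.1 + (1 - α) * q₁.2) + b * (α * q₂.1 + (1 - α) * q₂.2))
    (hle : p.1 ≤ p.2) (hp : p.2 - (a * q₁.2 + b * q₂.2) ≤ D) :
    α * max (a * R₁ + b * R₂ + γ * p.1 - (a * c₁ + b * c₂ + γ * D)) 0
        + (1 - α) * max (a * R₁ + b * R₂ + γ * p.2 - (a * c₁ + b * c₂ + γ * D)) 0
      ≤ a * (α * max (R₁ + γ * q₁.1 - c₁) 0 + (1 - α) * max (R₁ + γ * q₁.2 - c₁) 0)
        + b * (α * max (R₂ + γ * q₂.1 - c₂) 0 + (1 - α) * max (R₂ + γ * q₂.2 - c₂) 0) := by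
  have hα' : 0 ≤ 1 - α := by linarith [hα.2]
  have hcomb : ∀ u₁ u₂ : ℝ, a * u₁ + b * u₂ ≤ a * max u₁ 0 + b * max u₂ 0 := fun u₁ u₂ =>
    add_le_add (mul_le_mul_of_nonneg_left (le_max_left _ _) ha)
      (mul_le_mul_of_nonneg_left (le_max_left _ _) hb)
  have hnonneg : ∀ u₁ u₂ : ℝ, 0 ≤ a * max u₁ 0 + b * max u₂ 0 := fun u₁ u₂ => by positivity
  have hfst := mul_le_mul_of_nonneg_left
    (hcomb (R₁ + γ * q₁.1 - c₁) (R₂ + γ * q₂.1 - c₂)) hα.1.le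
  have hfst0 := mul_nonneg hα.1.le (hnonneg (R₁ + γ * q₁.1 - c₁) (R₂ + γ * q₂.1 - c₂))
  have hsnd := mul_le_mul_of_nonneg_left
    (hcomb (R₁ + γ * q₁.2 - c₁) (R₂ + γ * q₂.2 - c₂)) hα'
  have hsnd0 := mul_nonneg hα' (hnonneg (R₁ + γ * q₁.2 - c₁) (R₂ + γ * q₂.2 - c₂))
  have hγle := mul_le_mul_of_nonneg_left hle hγ
  have hγp := mul_le_mul_of_nonneg_left (mul_le_mul_of_nonneg_left hp hγ) hα'
  have hγm := congrArg (γ * ·) hmean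
  have hγD := mul_nonneg hγ hD
  rcases le_total (a * R₁ + b * R₂ + γ * p.1 - (a * c₁ + b * c₂ + γ * D)) 0 with h1 | h1 <;>
  rcases le_total (a * R₁ + b * R₂ + γ * p.2 - (a * c₁ + b * c₂ + γ * D)) 0 with h2 | h2
  · rw [max_eq_right h1, max_eq_right h2]
    linarith
  · rw [max_eq_right h1, max_eq_left h2]
    linarith
  · rw [max_eq_right h2, max_eq_right (by linarith)]
    linarith
  · rw [max_eq_left h1, max_eq_left h2]
    linarith

lemma fixedPoint_mean (M : MDP X A) {α : ℝ} (hα : α ∈ Set.Ioo (0:ℝ) 1) {π : X → A → ℝ}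
    (hπ : IsPolicy π) {r : X → A → X → ℝ} {Q : X → A → ℝ × ℝ}
    (hQ : diatomicT { M with r := r } α π Q = Q) (x : X) (a : A) :
    α * (Q x a).1 + (1 - α) * (Q x a).2 = nextExp M π x a fun x' a' =>
      r x a x' + M.γ * (α * (Q x' a').1 + (1 - α) * (Q x' a').2) := by
  have := isProbabilityMeasure_diatomicMeasure { M with r := r } hα hπ Q x a
  have h := avarLeft_add_avarRight _ hα
    (integrable_diatomicMeasure { M with r := r } α π Q x a fun v => v)
  rw [integral_diatomicMeasure _ hα hπ] at h
  rw [← congrFun₂ hQ x a]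
  refine h.trans ?_
  simp only [nextExp]
  exact Finset.sum_congr rfl fun x' _ => Finset.sum_congr rfl fun a' _ => by ring

lemma fixedPoint_fst_le_snd (M : MDP X A) {α : ℝ} (hα : α ∈ Set.Ioo (0:ℝ) 1) {π : X → A → ℝ}
    (hπ : IsPolicy π) {r : X → A → X → ℝ} {Q : X → A → ℝ × ℝ}
    (hQ : diatomicT { M with r := r } α π Q = Q) (x : X) (a : A) : (Q x a).1 ≤ (Q x a).2 := by
  have := isProbabilityMeasure_diatomicMeasure { M with r := r } hα hπ Q x a
  rw [← congrFun₂ hQ x a]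
  exact avarLeft_le_avarRight _ hα
    (integrable_diatomicMeasure { M with r := r } α π Q x a fun v => v)

lemma fixedPoint_snd_le (M : MDP X A) {α : ℝ} (hα : α ∈ Set.Ioo (0:ℝ) 1) {π : X → A → ℝ}
    (hπ : IsPolicy π) {r : X → A → X → ℝ} {Q : X → A → ℝ × ℝ}
    (hQ : diatomicT { M with r := r } α π Q = Q) (x : X) (a : A) (c : ℝ) :
    (1 - α) * (Q x a).2 ≤ (1 - α) * c + nextExp M π x a fun x' a' =>
      α * max (r x a x' + M.γ * (Q x' a').1 - c) 0
        + (1 - α) * max (r x a x' + M.γ * (Q x' a').2 - c) 0 := by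
  have := isProbabilityMeasure_diatomicMeasure { M with r := r } hα hπ Q x a
  have h := avarRight_le _ hα
    (integrable_diatomicMeasure { M with r := r } α π Q x a fun v => v) c
  rw [integral_diatomicMeasure _ hα hπ] at h
  rw [← congrArg Prod.snd (congrFun₂ hQ x a)]
  exact h

lemma exists_fixedPoint_snd_eq (M : MDP X A) {α : ℝ} (hα : α ∈ Set.Ioo (0:ℝ) 1) {π : X → A → ℝ}
    (hπ : IsPolicy π) {r : X → A → X → ℝ} {Q : X → A → ℝ × ℝ}
    (hQ : diatomicT { M with r := r } α π Q = Q) (x : X) (a : A) :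
    ∃ c, (1 - α) * (Q x a).2 = (1 - α) * c + nextExp M π x a fun x' a' =>
      α * max (r x a x' + M.γ * (Q x' a').1 - c) 0
        + (1 - α) * max (r x a x' + M.γ * (Q x' a').2 - c) 0 := by
  have := isProbabilityMeasure_diatomicMeasure { M with r := r } hα hπ Q x a
  obtain ⟨c, h⟩ := exists_avarRight_eq _ hα
    (integrable_diatomicMeasure { M with r := r } α π Q x a fun v => v)
  rw [integral_diatomicMeasure _ hα hπ] at h
  refine ⟨c, ?_⟩
  rw [← congrArg Prod.snd (congrFun₂ hQ x a)]
  exact h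

/-- Rewards bounded above by `b` give a right value of at most `b / (1 - γ)`. -/
lemma fixedPoint_snd_le_of_reward_le (M : MDP X A) {α : ℝ} (hα : α ∈ Set.Ioo (0:ℝ) 1)
    {π : X → A → ℝ} (hπ : IsPolicy π) {r : X → A → X → ℝ} {Q : X → A → ℝ × ℝ}
    (hQ : diatomicT { M with r := r } α π Q = Q) {b : ℝ} (hr : ∀ x a x', r x a x' ≤ b)
    (x : X) (a : A) :
    (1 - M.γ) * (Q x a).2 ≤ b := by
  have hγ : 0 < 1 - M.γ := by linarith [M.γ_lt_one]
  have hα' : 0 < 1 - α := by linarith [hα.2]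
  obtain ⟨B, rfl⟩ : ∃ B, b = (1 - M.γ) * B := ⟨b / (1 - M.γ), by field_simp⟩
  refine mul_le_mul_of_nonneg_left (sub_nonpos.1 ?_) hγ.le
  refine nonpos_of_contraction (f := fun x a => (Q x a).2 - B) M.γ_lt_one
    (fun D hD h y c => ?_) x a
  have hbd := fixedPoint_snd_le M hα hπ hQ y c (B + M.γ * D)
  have hzero : (nextExp M π y c fun x' a' =>
      α * max (r y c x' + M.γ * (Q x' a').1 - (B + M.γ * D)) 0
        + (1 - α) * max (r y c x' + M.γ * (Q x' a').2 - (B + M.γ * D)) 0) = 0 := by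
    refine Eq.trans ?_ (nextExp_const M hπ y c 0)
    congr 1
    ext x' a'
    have h1 := mul_le_mul_of_nonneg_left (fixedPoint_fst_le_snd M hα hπ hQ x' a') M.γ_nonneg
    have h2 := mul_le_mul_of_nonneg_left (h x' a') M.γ_nonneg
    have h3 := hr y c x'
    rw [max_eq_right (by linarith), max_eq_right (by linarith)]
    ring
  rw [hzero, add_zero] at hbd
  have := le_of_mul_le_mul_left hbd hα'
  linarith

/-- The mean of the diatomic fixed point is linear in the reward. -/
lemma fixedPoint_mean_linear (M : MDP X A) {α : ℝ} (hα : α ∈ Set.Ioo (0:ℝ) 1) {π : X → A → ℝ}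
    (hπ : IsPolicy π) {a b : ℝ} {r₁ r₂ : X → A → X → ℝ} {Q₁ Q₂ Q : X → A → ℝ × ℝ}
    (hQ₁ : diatomicT { M with r := r₁ } α π Q₁ = Q₁)
    (hQ₂ : diatomicT { M with r := r₂ } α π Q₂ = Q₂)
    (hQ : diatomicT { M with r := fun x c x' => a * r₁ x c x' + b * r₂ x c x' } α π Q = Q)
    (x : X) (c : A) :
    α * (Q x c).1 + (1 - α) * (Q x c).2
      = a * (α * (Q₁ x c).1 + (1 - α) * (Q₁ x c).2)
        + b * (α * (Q₂ x c).1 + (1 - α) * (Q₂ x c).2) := by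
  set m₁ : X → A → ℝ := fun x c => α * (Q₁ x c).1 + (1 - α) * (Q₁ x c).2 with hm₁
  set m₂ : X → A → ℝ := fun x c => α * (Q₂ x c).1 + (1 - α) * (Q₂ x c).2 with hm₂
  set m : X → A → ℝ := fun x c => α * (Q x c).1 + (1 - α) * (Q x c).2 with hm
  have hdiff : ∀ y d, m y d - (a * m₁ y d + b * m₂ y d) = nextExp M π y d fun x' a' =>
      M.γ * (m x' a' - (a * m₁ x' a' + b * m₂ x' a')) := by
    intro y d
    rw [hm, hm₁, hm₂]
    simp only
    rw [fixedPoint_mean M hα hπ hQ, fixedPoint_mean M hα hπ hQ₁, fixedPoint_mean M hα hπ hQ₂,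
      ← nextExp_lin]
    simp only [nextExp, ← Finset.sum_sub_distrib]
    exact Finset.sum_congr rfl fun x' _ => Finset.sum_congr rfl fun a' _ => by ring
  have hle := nonpos_of_contraction (f := fun y d => m y d - (a * m₁ y d + b * m₂ y d))
    M.γ_lt_one (fun D _ h y d => by
      rw [hdiff, ← nextExp_const M hπ y d (M.γ * D)]
      exact nextExp_mono M hπ y d fun x' a' =>
        mul_le_mul_of_nonneg_left (h x' a') M.γ_nonneg) x c
  have hge := nonpos_of_contraction (f := fun y d => -(m y d - (a * m₁ y d + b * m₂ y d)))
    M.γ_lt_one (fun D _ h y d => by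
      rw [hdiff, neg_le, ← nextExp_const M hπ y d (-(M.γ * D))]
      exact nextExp_mono M hπ y d fun x' a' => by
        have := mul_le_mul_of_nonneg_left (h x' a') M.γ_nonneg
        linarith) x c
  change m x c = a * m₁ x c + b * m₂ x c
  linarith

/-- The right value is sublinear in the reward. -/
lemma fixedPoint_snd_sublinear (M : MDP X A) {α : ℝ} (hα : α ∈ Set.Ioo (0:ℝ) 1) {π : X → A → ℝ}
    (hπ : IsPolicy π) {a b : ℝ} {r₁ r₂ : X → A → X → ℝ} {Q₁ Q₂ Q : X → A → ℝ × ℝ}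
    (hQ₁ : diatomicT { M with r := r₁ } α π Q₁ = Q₁)
    (hQ₂ : diatomicT { M with r := r₂ } α π Q₂ = Q₂)
    (hQ : diatomicT { M with r := fun x c x' => a * r₁ x c x' + b * r₂ x c x' } α π Q = Q)
    (ha : 0 ≤ a) (hb : 0 ≤ b) (x : X) (c : A) :
    (Q x c).2 ≤ a * (Q₁ x c).2 + b * (Q₂ x c).2 := by
  have hα' : 0 < 1 - α := by linarith [hα.2]
  refine sub_nonpos.1 (nonpos_of_contraction
    (f := fun x c => (Q x c).2 - (a * (Q₁ x c).2 + b * (Q₂ x c).2)) M.γ_lt_one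
    (fun D hD h y d => ?_) x c)
  obtain ⟨c₁, h₁⟩ := exists_fixedPoint_snd_eq M hα hπ hQ₁ y d
  obtain ⟨c₂, h₂⟩ := exists_fixedPoint_snd_eq M hα hπ hQ₂ y d
  have hbd := (fixedPoint_snd_le M hα hπ hQ y d (a * c₁ + b * c₂ + M.γ * D)).trans
    (add_le_add_right (nextExp_mono M hπ y d fun x' a' => max_diatomic_le hα M.γ_nonneg hD ha hb
      (fixedPoint_mean_linear M hα hπ hQ₁ hQ₂ hQ x' a')
      (fixedPoint_fst_le_snd M hα hπ hQ x' a') (h x' a')) _)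
  rw [nextExp_lin] at hbd
  refine le_of_mul_le_mul_left ?_ hα'
  linear_combination hbd - a * h₁ - b * h₂

end Bellman

theorem stmt13 (M : MDP X A) (α : ℝ) (hα : α ∈ Set.Ioo (0:ℝ) 1) (x : X)
    (π : X → A → ℝ) (hπ : IsPolicy π)
    (Qfix : (X → A → X → ℝ) → X → A → ℝ × ℝ)
    (hfix : ∀ rw : X → A → X → ℝ,
      diatomicT { M with r := rw } α π (Qfix rw) = Qfix rw)
    (V1 V2 : (X → A → X → ℝ) → X → ℝ)
    (hcoh : ∀ (rw : X → A → X → ℝ) (y : X) (a : A), 0 < π y a →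
      Qfix rw y a = (V1 rw y, V2 rw y))
    (η : (X → A → X → ℝ) → ℝ)
    (hη : ∀ u : X → A → X → ℝ,
      η u = (1 - M.γ) * V2 (fun y a y' => -(u y a y')) x) :
    (∀ (u : X → A → X → ℝ) (β : ℝ),
        η (fun y a y' => u y a y' + β) = η u - β) ∧
    (∀ u1 u2 : X → A → X → ℝ,
        η (fun y a y' => u1 y a y' + u2 y a y') ≤ η u1 + η u2) ∧
    (∀ (β : ℝ) (u : X → A → X → ℝ), 0 ≤ β →
        η (fun y a y' => β * u y a y') = β * η u) ∧
    (∀ u1 u2 : X → A → X → ℝ, (∀ y a y', u1 y a y' ≤ u2 y a y') →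
        η u2 ≤ η u1) := by
  have hγ : 0 < 1 - M.γ := by linarith [M.γ_lt_one]
  obtain ⟨a₀, ha₀⟩ : ∃ a, 0 < π x a := by
    by_contra! h
    have := Finset.sum_nonpos fun a (_ : a ∈ Finset.univ) => h a
    linarith [hπ.2 x]
  have hη' : ∀ u, η u = (1 - M.γ) * (Qfix (fun y a y' => -(u y a y')) x a₀).2 := fun u => by
    rw [hη, hcoh _ x a₀ ha₀]
  have hlin : ∀ (s t : ℝ) (u₁ u₂ : X → A → X → ℝ), 0 ≤ s → 0 ≤ t →
      η (fun y a y' => s * u₁ y a y' + t * u₂ y a y') ≤ s * η u₁ + t * η u₂ := by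
    intro s t u₁ u₂ hs ht
    have hrw : (fun y a y' => -(s * u₁ y a y' + t * u₂ y a y'))
        = fun y a y' => s * -(u₁ y a y') + t * -(u₂ y a y') := by
      funext y a y'
      ring
    have h := hfix fun y a y' => s * -(u₁ y a y') + t * -(u₂ y a y')
    have := mul_le_mul_of_nonneg_left
      (fixedPoint_snd_sublinear M hα hπ
        (hfix fun y a y' => -(u₁ y a y')) (hfix fun y a y' => -(u₂ y a y')) h hs ht
        x a₀) hγ.le
    rw [hη', hη', hη', hrw]
    linarith
  have hbd : ∀ (u : X → A → X → ℝ) (b : ℝ), (∀ y a y', -b ≤ u y a y') → η u ≤ b := by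
    intro u b hu
    rw [hη']
    exact fixedPoint_snd_le_of_reward_le M hα hπ (hfix _)
      (fun y a y' => by linarith [hu y a y']) x a₀
  have hadd : ∀ u₁ u₂ : X → A → X → ℝ,
      η (fun y a y' => u₁ y a y' + u₂ y a y') ≤ η u₁ + η u₂ := fun u₁ u₂ => by
    simpa using hlin 1 1 u₁ u₂ zero_le_one zero_le_one
  have hmul : ∀ (s : ℝ) (u : X → A → X → ℝ), 0 ≤ s →
      η (fun y a y' => s * u y a y') ≤ s * η u := fun s u hs => by
    simpa using hlin s 0 u u hs le_rfl
  have hshift : ∀ (u : X → A → X → ℝ) (β : ℝ),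
      η (fun y a y' => u y a y' + β) ≤ η u - β := fun u β => by
    have := hadd u fun _ _ _ => β
    have := hbd (fun _ _ _ => β) (-β) fun _ _ _ => by simp
    linarith
  refine ⟨fun u β => le_antisymm (hshift u β) ?_, hadd, fun β u hβ => ?_, fun u₁ u₂ hu => ?_⟩
  · have := hshift (fun y a y' => u y a y' + β) (-β)
    simp only [add_neg_cancel_right] at this
    linarith
  · refine le_antisymm (hmul β u hβ) ?_
    rcases hβ.eq_or_lt with rfl | hpos
    · have := hadd (fun _ _ _ => 0) fun _ _ _ => 0
      simp only [add_zero] at this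
      simp only [zero_mul]
      linarith
    · have := hmul β⁻¹ (fun y a y' => β * u y a y') (inv_nonneg.2 hβ)
      simp only [inv_mul_cancel_left₀ hpos.ne'] at this
      rwa [← div_eq_inv_mul, le_div_iff₀' hpos] at this
  · have h := hadd u₁ fun y a y' => u₂ y a y' - u₁ y a y'
    simp only [add_sub_cancel] at h
    have := hbd (fun y a y' => u₂ y a y' - u₁ y a y') 0 fun y a y' => by
      linarith [hu y a y']
    linarith

end
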